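/- Let d ≥ 1, let p_1 ≤ p_2 ≤ … ≤ p_d be positive reals, each an integer power of 2, let n ≥ 1 be an integer, and let D = {(n_1 p_1,…,n_d p_d) : n_1,…,n_d ∈ ℕ, Σ_i n_i = n}. Then there exists a subset X ⊆ D with |X| ≤ d such that for every weight vector w ∈ ℝ^d, min_{x∈X} ‖x‖_(w) ≤ 2·min_{x∈D} ‖x‖_(w). -/

import Mathlib

/-- The vector of absolute values of the coordinates of `x`, sorted in decreasing order. -/
noncomputable def absSortDesc {d : ℕ} (x : Fin d → ℝ) : Fin d → ℝ :=
  fun k => |x (Tuple.sort (fun i => |x i|) k.rev)|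

/-- The ordered norm `‖x‖_(w) = Σ_k w_k (|x|↓)_k`. -/
noncomputable def orderedNorm {d : ℕ} (w x : Fin d → ℝ) : ℝ :=
  ∑ k, w k * absSortDesc x k

/-- The top-`k` norm: the sum of the `k` largest coordinates of `|x|`. -/
noncomputable def topkNorm {d : ℕ} (k : ℕ) (x : Fin d → ℝ) : ℝ :=
  ∑ i ∈ Finset.univ.filter (fun i : Fin d => (i : ℕ) < k), absSortDesc x i

/-- A weight vector: nonincreasing, nonnegative, nonzero. -/
def IsWeightVector {d : ℕ} (w : Fin d → ℝ) : Prop :=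
  Antitone w ∧ (∀ k, 0 ≤ w k) ∧ w ≠ 0

/-- A symmetric monotonic norm on `ι → ℝ`. -/
def IsSymMonotoneNorm {ι : Type*} [Fintype ι] (f : (ι → ℝ) → ℝ) : Prop :=
  (∀ x, f x = 0 ↔ x = 0) ∧
  (∀ (a : ℝ) (x : ι → ℝ), f (a • x) = |a| * f x) ∧
  (∀ x y : ι → ℝ, f (x + y) ≤ f x + f y) ∧
  (∀ (σ : Equiv.Perm ι) (x : ι → ℝ), f (x ∘ σ) = f x) ∧
  (∀ x y : ι → ℝ, (∀ i, 0 ≤ x i) → (∀ i, x i ≤ y i) → f x ≤ f y)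

/-- Feasible load vectors of the Machine-Loads-Identical-Jobs problem. -/
def MLIJ {d : ℕ} (p : Fin d → ℝ) (n : ℕ) : Set (Fin d → ℝ) :=
  { x | ∃ m : Fin d → ℕ, (∑ i, m i) = n ∧ ∀ i, x i = (m i : ℝ) * p i }

/-- The dual of the ordered norm. -/
noncomputable def dualOrderedNorm {d : ℕ} (w y : Fin d → ℝ) : ℝ :=
  sSup { r : ℝ | ∃ x : Fin d → ℝ, orderedNorm w x ≤ 1 ∧ r = ∑ i, y i * x i }

/-- The coordinates of `x` sorted in increasing order. -/
noncomputable def sortAsc {n : ℕ} (x : Fin n → ℝ) : Fin n → ℝ :=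
  fun k => x (Tuple.sort x k)

/-- Distance vector induced by a set of open facilities. -/
noncomputable def distVec {X : Type*} [MetricSpace X] (F : Finset X) : X → ℝ :=
  fun j => sInf ((fun c => dist j c) '' (F : Set X))

/-- `x(l)`: the vector with the first `l+1` coordinates (indices `≤ l`) equal to
`n / Σ_{j ≤ l} 1/p_j` and zero elsewhere. -/
noncomputable def vertexX {d : ℕ} (p : Fin d → ℝ) (n : ℝ) (l : Fin d) : Fin d → ℝ :=
  fun i => if i ≤ l then n / (∑ j ∈ Finset.univ.filter (fun j : Fin d => j ≤ l), 1 / p j) else 0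

/-- Completion time of job `j` when job `j'` is assigned to machine `a j'` and jobs are
processed on each machine in the order induced by the priority permutation `π`. -/
noncomputable def completionTime {n d : ℕ} (p : Fin d → Fin n → ℝ)
    (a : Fin n → Fin d) (π : Equiv.Perm (Fin n)) : Fin n → ℝ :=
  fun j => ∑ j' ∈ Finset.univ.filter (fun j' : Fin n => a j' = a j ∧ π j' ≤ π j), p (a j) j'

/-- A tour on `n` vertices starting at `v₀`: `τ 0 = v₀` and `τ` is a bijection from
`{0, …, n-1}` onto the vertex set. -/
def IsTour {V : Type*} (n : ℕ) (v₀ : V) (τ : ℕ → V) : Prop :=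
  τ 0 = v₀ ∧ Set.BijOn τ (Set.Iio n) Set.univ

/-- The visit times of the vertices `τ 0, …, τ (n-1)` of a tour. -/
noncomputable def tourVisitTimes {V : Type*} [MetricSpace V] (n : ℕ) (τ : ℕ → V) : Fin n → ℝ :=
  fun i => ∑ j ∈ Finset.range (i : ℕ), dist (τ j) (τ (j + 1))

/-- Cover time of element `e` under the ordering `π` of the subsets `S 0, …, S (m-1)`:
the position (in `{1, …, m}`) of the first subset containing `e`. -/
noncomputable def coverTime {n m : ℕ} (S : Fin m → Finset (Fin n))
    (π : Equiv.Perm (Fin m)) (e : Fin n) : ℕ :=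
  1 + sInf {t : ℕ | ∃ h : t < m, e ∈ S (π ⟨t, h⟩)}

lemma absSortDesc_antitone {d : ℕ} (x : Fin d → ℝ) : Antitone (absSortDesc x) := by
  intro a b hab
  exact Tuple.monotone_sort (fun i => |x i|) (Fin.rev_le_rev.mpr hab)

lemma exists_perm_absSortDesc {d : ℕ} (x : Fin d → ℝ) :
    ∃ τ : Equiv.Perm (Fin d), ∀ k, absSortDesc x k = |x (τ k)| :=
  ⟨Fin.revPerm.trans (Tuple.sort fun i => |x i|), fun _ => rfl⟩

lemma sum_perm_mul_abs_le_orderedNorm {d : ℕ} {w : Fin d → ℝ} (hw : Antitone w)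
    (x : Fin d → ℝ) (σ : Equiv.Perm (Fin d)) :
    ∑ i, w (σ i) * |x i| ≤ orderedNorm w x := by
  obtain ⟨τ, hτ⟩ := exists_perm_absSortDesc x
  have h := (hw.monovary (absSortDesc_antitone x)).sum_comp_perm_mul_le_sum_mul
    (σ := τ.trans σ)
  refine le_trans (le_of_eq ?_) h
  rw [← Equiv.sum_comp τ]
  simp [hτ]

lemma exists_perm_orderedNorm_eq {d : ℕ} (w x : Fin d → ℝ) :
    ∃ σ : Equiv.Perm (Fin d), orderedNorm w x = ∑ i, w (σ i) * |x i| := by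
  obtain ⟨τ, hτ⟩ := exists_perm_absSortDesc x
  refine ⟨τ.symm, ?_⟩
  rw [← Equiv.sum_comp τ]
  simp [hτ, orderedNorm]

/-- Moving `a` units of load from coordinate `l` to coordinate `j`, of which only `b ≤ a` units
arrive, does not increase an ordered norm if coordinate `j` ends up at most at the old level
of coordinate `l`. -/
lemma orderedNorm_transfer_le {d : ℕ} {w : Fin d → ℝ} (hw : Antitone w) (hw0 : ∀ k, 0 ≤ w k)
    {x y : Fin d → ℝ} (hx : ∀ i, 0 ≤ x i) (hy : ∀ i, 0 ≤ y i) {j l : Fin d} (hjl : j ≠ l)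
    {a b : ℝ} (hb : 0 ≤ b) (hba : b ≤ a) (hle : x j + b ≤ x l)
    (hyx : ∀ i, y i = x i + (if i = j then b else 0) - (if i = l then a else 0)) :
    orderedNorm w y ≤ orderedNorm w x := by
  obtain ⟨σ, hσ⟩ := exists_perm_orderedNorm_eq w y
  have e : ∑ i, w (σ i) * |y i| = ∑ i, w (σ i) * x i + w (σ j) * b - w (σ l) * a := by
    simp only [abs_of_nonneg (hy _)]
    simp only [hyx, mul_sub, mul_add, Finset.sum_sub_distrib,
      Finset.sum_add_distrib, mul_ite, mul_zero, Finset.sum_ite_eq', Finset.mem_univ, if_true]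
  rw [hσ, e]
  rcases le_total (w (σ j)) (w (σ l)) with h | h
  · refine le_trans ?_ (sum_perm_mul_abs_le_orderedNorm hw x σ)
    simp only [abs_of_nonneg (hx _)]
    linarith [mul_le_mul h hba hb (hw0 (σ l))]
  · refine le_trans ?_ (sum_perm_mul_abs_le_orderedNorm hw x ((Equiv.swap j l).trans σ))
    have e2 : ∑ i, w (((Equiv.swap j l).trans σ) i) * |x i| =
        ∑ i, w (σ i) * x i + (w (σ l) - w (σ j)) * x j + (w (σ j) - w (σ l)) * x l := by
      have : ∀ i, w (((Equiv.swap j l).trans σ) i) * |x i| = w (σ i) * x i +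
          (if i = j then (w (σ l) - w (σ j)) * x j else 0) +
          (if i = l then (w (σ j) - w (σ l)) * x l else 0) := by
        intro i
        rw [abs_of_nonneg (hx i)]
        by_cases h1 : i = j
        · subst h1; simp [hjl]; ring
        · by_cases h2 : i = l
          · subst h2; simp [h1]; ring
          · simp [h1, h2, Equiv.swap_apply_of_ne_of_ne h1 h2]
      simp only [this, Finset.sum_add_distrib, Finset.sum_ite_eq', Finset.mem_univ, if_true]
    rw [e2]
    nlinarith [mul_le_mul_of_nonneg_left hba (hw0 (σ l)),
      mul_le_mul_of_nonneg_left hle (sub_nonneg.mpr h)]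

lemma last_mul_sum_le_sum_mul {d : ℕ} {a c : Fin (d + 1) → ℝ} (ha : Antitone a)
    (hc : ∀ k, 0 ≤ ∑ j, if j ≤ k then c j else 0) :
    a (Fin.last d) * ∑ i, c i ≤ ∑ i, a i * c i := by
  induction d with
  | zero => simp
  | succ d ih =>
    have h := ih (a := fun i => a i.castSucc) (c := fun i => c i.castSucc)
      (fun i j hij => ha (Fin.castSucc_le_castSucc_iff.mpr hij)) (fun k => by
        have := hc k.castSucc
        rw [Fin.sum_univ_castSucc, if_neg (Fin.castSucc_lt_last k).not_ge, add_zero] at this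
        simpa only [Fin.castSucc_le_castSucc_iff] using this)
    have h0 : 0 ≤ ∑ i : Fin (d + 1), c i.castSucc := by
      have := hc (Fin.last d).castSucc
      rw [Fin.sum_univ_castSucc] at this
      simpa [Fin.le_def, Nat.lt_succ_iff.mp (Fin.is_lt _)] using this
    have hl : a (Fin.last (d + 1)) ≤ a (Fin.last d).castSucc := ha (Fin.le_last _)
    rw [Fin.sum_univ_castSucc c, Fin.sum_univ_castSucc (fun i => a i * c i), mul_add]
    have := mul_le_mul_of_nonneg_right hl h0
    linarith

/-- Abel summation: pairing a nonnegative antitone sequence with one whose partial sums are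
nonnegative gives a nonnegative number. -/
lemma sum_antitone_mul_nonneg {d : ℕ} {a c : Fin d → ℝ} (ha : Antitone a) (ha0 : ∀ k, 0 ≤ a k)
    (hc : ∀ k, 0 ≤ ∑ j, if j ≤ k then c j else 0) : 0 ≤ ∑ i, a i * c i := by
  cases d with
  | zero => simp
  | succ d =>
    refine le_trans (mul_nonneg (ha0 _) ?_) (last_mul_sum_le_sum_mul ha hc)
    simpa [Fin.le_last] using hc (Fin.last d)

lemma exists_le_sum_eq {ι : Type*} [Fintype ι] (u : ι → ℕ) {n : ℕ} (h : n ≤ ∑ i, u i) :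
    ∃ m : ι → ℕ, (∀ i, m i ≤ u i) ∧ ∑ i, m i = n := by
  classical
  induction n with
  | zero => exact ⟨0, by simp, by simp⟩
  | succ n ih =>
    obtain ⟨m, hm, hs⟩ := ih (by omega)
    obtain ⟨j, hj⟩ : ∃ j, m j < u j := by
      by_contra! hcon
      have := Finset.sum_le_sum fun i (_ : i ∈ Finset.univ) => hcon i
      omega
    refine ⟨fun i => m i + if i = j then 1 else 0, fun i => ?_, ?_⟩
    · dsimp only
      split_ifs with hij
      · subst hij; omega
      · simpa using hm i
    · simp [Finset.sum_add_distrib, hs]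

/-- The total processing rate of the machines up to `l`. -/
noncomputable def prefixRate {d : ℕ} (p : Fin d → ℝ) (l : Fin d) : ℝ :=
  ∑ j, if j ≤ l then (p j)⁻¹ else 0

lemma prefixRate_pos {d : ℕ} {p : Fin d → ℝ} (hpos : ∀ i, 0 < p i) (l : Fin d) :
    0 < prefixRate p l := by
  refine Finset.sum_pos' (fun j _ => ?_) ⟨l, Finset.mem_univ _, by simp [hpos l]⟩
  have := inv_pos.mpr (hpos j)
  split_ifs <;> linarith

lemma prefixRate_mono {d : ℕ} {p : Fin d → ℝ} (hpos : ∀ i, 0 < p i) :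
    Monotone (prefixRate p) := by
  intro k l hkl
  refine Finset.sum_le_sum fun j _ => ?_
  have := inv_pos.mpr (hpos j)
  split_ifs with h1 h2 h2
  · rfl
  · exact absurd (h1.trans hkl) h2
  · exact this.le
  · rfl

/-- If the fractional balanced level `n / prefixRate p l` is at least `p l`, there is an integral
assignment to the machines up to `l` with all loads at most twice that level. -/
lemma exists_rounding {d : ℕ} {p : Fin d → ℝ} (hpos : ∀ i, 0 < p i) (hmono : Monotone p)
    {n : ℕ} {l : Fin d} (hl : p l * prefixRate p l ≤ n) :
    ∃ x ∈ MLIJ p n, ∀ i, 0 ≤ x i ∧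
      x i ≤ 2 * (n / prefixRate p l) * (if i ≤ l then 1 else 0) := by
  have hS := prefixRate_pos hpos l
  set T : ℝ := n / prefixRate p l with hT
  have hTl : p l ≤ T := by rwa [hT, le_div_iff₀ hS]
  have hT0 : 0 ≤ T := (hpos l).le.trans hTl
  obtain ⟨m, hm, hs⟩ := exists_le_sum_eq
    (fun i : Fin d => if i ≤ l then ⌊2 * T * (p i)⁻¹⌋₊ else 0) (n := n) (by
      have e : (n : ℝ) = ∑ j, if j ≤ l then T * (p j)⁻¹ else 0 := by
        have : (n : ℝ) = T * prefixRate p l := by rw [hT]; field_simp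
        rw [this, prefixRate, Finset.mul_sum]
        simp only [mul_ite, mul_zero]
      rw [← Nat.cast_le (α := ℝ), e]
      push_cast
      refine Finset.sum_le_sum fun i _ => ?_
      split_ifs with hi
      · have h1 : 1 ≤ T * (p i)⁻¹ := by
          rw [← div_eq_mul_inv, le_div_iff₀ (hpos i), one_mul]
          exact (hmono hi).trans hTl
        have := Nat.lt_floor_add_one (2 * T * (p i)⁻¹)
        linarith
      · simp)
  refine ⟨fun i => m i * p i, ⟨m, hs, fun _ => rfl⟩, fun i =>
    ⟨mul_nonneg (Nat.cast_nonneg _) (hpos i).le, ?_⟩⟩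
  have hmi := hm i
  dsimp only at hmi ⊢
  split_ifs at hmi ⊢ with hi
  · have h2 : (m i : ℝ) ≤ 2 * T * (p i)⁻¹ :=
      (Nat.cast_le.mpr hmi).trans (Nat.floor_le (by have := hpos i; positivity))
    rw [← div_eq_mul_inv, le_div_iff₀ (hpos i)] at h2
    linarith
  · simp [Nat.le_zero.mp hmi]

lemma orderedNorm_le_of_le_prefix {d : ℕ} {w x : Fin d → ℝ} (hw : Antitone w)
    (hw0 : ∀ k, 0 ≤ w k) {l : Fin d} {t : ℝ} (ht : 0 ≤ t)
    (hx : ∀ i, 0 ≤ x i ∧ x i ≤ t * (if i ≤ l then 1 else 0)) :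
    orderedNorm w x ≤ t * ∑ j, if j ≤ l then w j else 0 := by
  obtain ⟨σ, hσ⟩ := exists_perm_orderedNorm_eq w x
  have hind : Antitone fun i : Fin d => if i ≤ l then (1 : ℝ) else 0 := by
    intro a b hab
    dsimp only
    split_ifs with h1 h2 h2
    · rfl
    · exact absurd (hab.trans h1) h2
    · exact zero_le_one
    · rfl
  calc orderedNorm w x = ∑ i, w (σ i) * x i := by
        rw [hσ]; exact Finset.sum_congr rfl fun i _ => by rw [abs_of_nonneg (hx i).1]
    _ ≤ ∑ i, w (σ i) * (t * (if i ≤ l then 1 else 0)) :=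
        Finset.sum_le_sum fun i _ => mul_le_mul_of_nonneg_left (hx i).2 (hw0 _)
    _ = t * ∑ i, w (σ i) * (if i ≤ l then 1 else 0) := by
        rw [Finset.mul_sum]; exact Finset.sum_congr rfl fun i _ => by ring
    _ ≤ t * ∑ i, w i * (if i ≤ l then 1 else 0) :=
        mul_le_mul_of_nonneg_left (hw.monovary hind).sum_comp_perm_mul_le_sum_mul ht
    _ = t * ∑ j, if j ≤ l then w j else 0 := by simp

lemma exists_nat_mul_eq_of_two_zpow_le {a b : ℝ} (ha : ∃ z : ℤ, a = 2 ^ z)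
    (hb : ∃ z : ℤ, b = 2 ^ z) (hab : a ≤ b) : ∃ r : ℕ, b = r * a := by
  obtain ⟨u, rfl⟩ := ha
  obtain ⟨v, rfl⟩ := hb
  have huv : u ≤ v := (zpow_le_zpow_iff_right₀ one_lt_two).mp hab
  refine ⟨2 ^ (v - u).toNat, ?_⟩
  have h : ((v - u).toNat : ℤ) = v - u := Int.toNat_of_nonneg (by omega)
  push_cast
  rw [← zpow_natCast, h, ← zpow_add₀ two_ne_zero]
  congr 1
  omega

/-- If the balanced level of the machines up to `b` is below `p b`, and some machine `l ≥ b` is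
used, then some machine before `b` can take one more job without exceeding `p b`. -/
lemma exists_lt_add_le {d : ℕ} {p : Fin d → ℝ} (hpos : ∀ i, 0 < p i) (hmono : Monotone p)
    (hpow : ∀ i, ∃ z : ℤ, p i = 2 ^ z) {m : Fin d → ℕ} {b l : Fin d}
    (hb : ((∑ i, m i : ℕ) : ℝ) < p b * prefixRate p b) (hbl : b ≤ l) (hl : 0 < m l) :
    ∃ j < b, m j * p j + p j ≤ p b := by
  by_contra! hcon
  refine absurd hb (not_lt.mpr ?_)
  have e : p b * prefixRate p b = ∑ i, ((if i < b then p b * (p i)⁻¹ else 0) +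
      (if i = b then 1 else 0)) := by
    rw [prefixRate, Finset.mul_sum]
    refine Finset.sum_congr rfl fun i _ => ?_
    rcases lt_trichotomy i b with h | h | h
    · simp [h, h.le, h.ne]
    · subst h; simp [(hpos i).ne']
    · simp [h.not_ge, h.not_gt, h.ne']
  have e2 : p b * prefixRate p b = ∑ i, ((if i < b then p b * (p i)⁻¹ else 0) +
      (if i = l then 1 else 0)) := by
    rw [e]; simp [Finset.sum_add_distrib]
  rw [e2]
  push_cast
  refine Finset.sum_le_sum fun i _ => ?_
  by_cases h : i < b
  · obtain ⟨r, hr⟩ := exists_nat_mul_eq_of_two_zpow_le (hpow i) (hpow b) (hmono h.le)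
    have h1 := hcon i h
    rw [hr, ← add_one_mul] at h1
    have h2 : (r : ℝ) < m i + 1 := lt_of_mul_lt_mul_right h1 (hpos i).le
    have h3 : r ≤ m i := by
      have : r < m i + 1 := by exact_mod_cast h2
      omega
    rw [if_pos h, if_neg (h.trans_le hbl).ne, hr, mul_assoc, mul_inv_cancel₀ (hpos i).ne']
    simpa using h3
  · rw [if_neg h, zero_add]
    split_ifs with hil
    · subst hil; exact_mod_cast hl
    · exact Nat.cast_nonneg _

/-- Machines whose balanced level is below their own processing time are not needed. -/
lemma exists_supported_orderedNorm_le {d : ℕ} {p : Fin d → ℝ} (hpos : ∀ i, 0 < p i)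
    (hmono : Monotone p) (hpow : ∀ i, ∃ z : ℤ, p i = 2 ^ z) {n : ℕ}
    {w : Fin d → ℝ} (hw : Antitone w) (hw0 : ∀ k, 0 ≤ w k) {b : Fin d}
    (hb : (n : ℝ) < p b * prefixRate p b) (m : Fin d → ℕ) (hm : ∑ i, m i = n) :
    ∃ m' : Fin d → ℕ, ∑ i, m' i = n ∧ (∀ i, b ≤ i → m' i = 0) ∧
      orderedNorm w (fun i => m' i * p i) ≤ orderedNorm w (fun i => m i * p i) := by
  induction hN : (∑ i, if b ≤ i then m i else 0) using Nat.strong_induction_on generalizing m with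
  | _ N ih =>
  by_cases hl : ∃ l, b ≤ l ∧ 0 < m l
  · obtain ⟨l, hbl, hl⟩ := hl
    obtain ⟨j, hjb, hj⟩ := exists_lt_add_le hpos hmono hpow (by rwa [hm]) hbl hl
    have hjl : j ≠ l := (hjb.trans_le hbl).ne
    let m₁ : Fin d → ℕ := fun i => if i = j then m j + 1 else if i = l then m l - 1 else m i
    have h₁ : ∀ i, m₁ i + (if i = l then 1 else 0) = m i + (if i = j then 1 else 0) := by
      intro i
      by_cases hij : i = j
      · subst hij; simp [m₁, hjl]
      · by_cases hil : i = l
        · subst hil; simp [m₁, hij]; omega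
        · simp [m₁, hij, hil]
    have hs : ∑ i, m₁ i = n := by
      have := Finset.sum_congr rfl fun i (_ : i ∈ Finset.univ) => h₁ i
      simp only [Finset.sum_add_distrib, Finset.sum_ite_eq', Finset.mem_univ, if_true] at this
      omega
    have hlt : (∑ i, if b ≤ i then m₁ i else 0) < N := by
      rw [← hN]
      refine Finset.sum_lt_sum (fun i _ => ?_) ⟨l, Finset.mem_univ _, ?_⟩
      · have := h₁ i
        split_ifs at this ⊢ with h2 h3 h4 <;> omega
      · simp [hbl, m₁, hjl.symm]; omega
    obtain ⟨m', h1, h2, h3⟩ := ih _ hlt m₁ hs rfl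
    refine ⟨m', h1, h2, h3.trans ?_⟩
    have hpl : p b ≤ m l * p l := by
      have h4 : (1 : ℝ) ≤ m l := by exact_mod_cast hl
      nlinarith [hmono hbl, hpos l]
    refine orderedNorm_transfer_le hw hw0 (fun i => mul_nonneg (Nat.cast_nonneg _) (hpos i).le)
      (fun i => mul_nonneg (Nat.cast_nonneg _) (hpos i).le) hjl
      (hpos j).le (hmono (hjb.le.trans hbl)) (hj.trans hpl) fun i => ?_
    have h5 : (m₁ i : ℝ) + (if i = l then 1 else 0) = m i + (if i = j then 1 else 0) := by
      exact_mod_cast h₁ i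
    rw [← sub_eq_iff_eq_add.mpr h5.symm]
    split_ifs <;> subst_vars <;> ring
  · push Not at hl
    exact ⟨m, hm, fun i hi => Nat.le_zero.mp (hl i hi), le_rfl⟩

/-- A lower bound on the ordered norm of a load vector supported on an initial segment, in terms
of the balanced levels `t / prefixRate p l` with total job mass `t`. -/
lemma le_orderedNorm_of_supported {d : ℕ} {p : Fin d → ℝ} (hpos : ∀ i, 0 < p i)
    (hmono : Monotone p) {w x : Fin d → ℝ} (hw0 : ∀ k, 0 ≤ w k)
    {t M : ℝ} (ht : 0 < t) (hM0 : 0 ≤ M) (hx : ∀ i, 0 ≤ x i) {g : Fin d}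
    (hsupp : ∀ i, g < i → x i = 0) (hsum : ∑ i, x i * (p i)⁻¹ = t)
    (hM : ∀ l ≤ g, M * prefixRate p l ≤ t * ∑ j, if j ≤ l then w j else 0) :
    M ≤ orderedNorm w x := by
  obtain ⟨τ, hτ⟩ := exists_perm_absSortDesc x
  have hτ' : ∀ k, absSortDesc x k = x (τ k) := fun k => by rw [hτ, abs_of_nonneg (hx _)]
  let q : Fin d → ℝ := fun i => if i ≤ g then (p i)⁻¹ else 0
  have hq : Antitone q := by
    intro a b hab
    have := inv_pos.mpr (hpos a)
    dsimp only [q]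
    split_ifs with h1 h2 h2
    · exact inv_anti₀ (hpos a) (hmono hab)
    · exact absurd (hab.trans h1) h2
    · exact this.le
    · rfl
  have hxq : t ≤ ∑ k, absSortDesc x k * q k := by
    have h := (hq.monovary (absSortDesc_antitone x)).sum_comp_perm_mul_le_sum_mul (σ := τ)
    have e : ∑ k, q (τ k) * absSortDesc x k = t := by
      simp only [hτ']
      rw [Equiv.sum_comp τ fun i => q i * x i, ← hsum]
      refine Finset.sum_congr rfl fun i _ => ?_
      rcases le_or_gt i g with h | h
      · simp [q, h, mul_comm]
      · simp [hsupp i h]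
    rw [e] at h
    simpa only [mul_comm] using h
  have hpart : ∀ k, 0 ≤ ∑ j, if j ≤ k then t * w j - M * q j else 0 := by
    intro k
    have e : ∀ l, (∑ j, if j ≤ l then t * w j - M * q j else 0) =
        t * (∑ j, if j ≤ l then w j else 0) - M * ∑ j, if j ≤ l then q j else 0 := by
      intro l
      rw [Finset.mul_sum, Finset.mul_sum, ← Finset.sum_sub_distrib]
      exact Finset.sum_congr rfl fun j _ => by split_ifs <;> ring
    have eq : (∑ j, if j ≤ k then q j else 0) = prefixRate p (min k g) := by
      refine Finset.sum_congr rfl fun j _ => ?_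
      by_cases h1 : j ≤ k <;> by_cases h2 : j ≤ g <;> simp [q, h1, h2]
    have hW : (∑ j, if j ≤ min k g then w j else 0) ≤ ∑ j, if j ≤ k then w j else 0 := by
      refine Finset.sum_le_sum fun j _ => ?_
      by_cases h1 : j ≤ k <;> by_cases h2 : j ≤ g <;> simp [h1, h2, hw0 j]
    have := hM (min k g) (min_le_right _ _)
    rw [e, eq]
    nlinarith
  have h := sum_antitone_mul_nonneg (absSortDesc_antitone x) (fun _ => abs_nonneg _) hpart
  have e : ∑ k, absSortDesc x k * (t * w k - M * q k) =
      t * orderedNorm w x - M * ∑ k, absSortDesc x k * q k := by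
    rw [orderedNorm, Finset.mul_sum, Finset.mul_sum, ← Finset.sum_sub_distrib]
    exact Finset.sum_congr rfl fun k _ => by ring
  rw [e] at h
  have h2 := mul_le_mul_of_nonneg_left hxq hM0
  exact le_of_mul_le_mul_left (by linarith) ht

/-- Lemma: a 2-approximate portfolio of size at most `d` for ordered norms over
doubling MLIJ instances. -/
theorem stmt17 {d : ℕ} (hd : 1 ≤ d) (p : Fin d → ℝ) (hpos : ∀ i, 0 < p i)
    (hmono : Monotone p) (hpow : ∀ i, ∃ z : ℤ, p i = 2 ^ z) (n : ℕ) (hn : 1 ≤ n) :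
    ∃ X : Set (Fin d → ℝ), X ⊆ MLIJ p n ∧ X.Finite ∧ X.ncard ≤ d ∧
      ∀ w : Fin d → ℝ, IsWeightVector w →
        ∀ y ∈ MLIJ p n, ∃ x ∈ X, orderedNorm w x ≤ 2 * orderedNorm w y := by
  classical
  let good : Finset (Fin d) := Finset.univ.filter fun l => p l * prefixRate p l ≤ n
  have hgood : ∀ l, l ∈ good ↔ p l * prefixRate p l ≤ n := fun l => by simp [good]
  have hdown : ∀ k l, k ≤ l → l ∈ good → k ∈ good := by
    intro k l hkl hl
    rw [hgood] at hl ⊢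
    exact (mul_le_mul (hmono hkl) (prefixRate_mono hpos hkl) (prefixRate_pos hpos k).le
      (hpos l).le).trans hl
  have hne : good.Nonempty := by
    let z : Fin d := ⟨0, hd⟩
    refine ⟨z, (hgood z).mpr ?_⟩
    have : prefixRate p z = (p z)⁻¹ := by
      rw [prefixRate, Finset.sum_eq_single z]
      · simp
      · intro j _ hj
        rw [if_neg]
        exact fun h => hj (le_antisymm h (Fin.mk_le_of_le_val (Nat.zero_le _)))
      · simp
    rw [this, mul_inv_cancel₀ (hpos z).ne']
    exact_mod_cast hn
  have hround : ∀ l, ∃ x : Fin d → ℝ, l ∈ good → x ∈ MLIJ p n ∧ ∀ i, 0 ≤ x i ∧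
      x i ≤ 2 * (n / prefixRate p l) * (if i ≤ l then 1 else 0) := by
    intro l
    by_cases hl : l ∈ good
    · obtain ⟨x, hx⟩ := exists_rounding hpos hmono ((hgood l).mp hl)
      exact ⟨x, fun _ => hx⟩
    · exact ⟨0, fun h => absurd h hl⟩
  choose x hx using hround
  refine ⟨↑(good.image x), ?_, Finset.finite_toSet _, ?_, ?_⟩
  · intro y hy
    obtain ⟨l, hl, rfl⟩ := Finset.mem_image.mp (Finset.mem_coe.mp hy)
    exact (hx l hl).1
  · rw [Set.ncard_coe_finset]
    exact Finset.card_image_le.trans ((Finset.card_le_univ _).trans (by simp))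
  rintro w ⟨hw, hw0, -⟩ y ⟨m, hm, hy⟩
  obtain rfl : y = fun i => m i * p i := funext hy
  have hn0 : (0 : ℝ) < n := by exact_mod_cast hn
  have hg := good.max'_mem hne
  set g := good.max' hne
  obtain ⟨m', hm', hsupp, hle⟩ : ∃ m' : Fin d → ℕ, ∑ i, m' i = n ∧ (∀ i, g < i → m' i = 0) ∧
      orderedNorm w (fun i => m' i * p i) ≤ orderedNorm w (fun i => m i * p i) := by
    by_cases hbad : ∃ b, g < b
    · let b : Fin d := ⟨g + 1, by
        obtain ⟨b, hb⟩ := hbad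
        have := b.is_lt
        rw [Fin.lt_def] at hb
        omega⟩
      have hgb : g < b := Fin.lt_def.mpr (Nat.lt_succ_self _)
      have hb : b ∉ good := fun h => absurd (good.le_max' b h) hgb.not_ge
      rw [hgood, not_le] at hb
      obtain ⟨m', h1, h2, h3⟩ := exists_supported_orderedNorm_le hpos hmono hpow hw hw0 hb m hm
      exact ⟨m', h1, fun i hi => h2 i (Fin.le_def.mpr (Fin.lt_def.mp hi)), h3⟩
    · exact ⟨m, hm, fun i hi => absurd ⟨i, hi⟩ hbad, le_rfl⟩
  obtain ⟨l, hl, hmin⟩ := good.exists_min_image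
    (fun l => (n / prefixRate p l) * ∑ j, if j ≤ l then w j else 0) hne
  have hS := prefixRate_pos hpos
  have hW : ∀ l, 0 ≤ ∑ j, if j ≤ l then w j else 0 := fun l =>
    Finset.sum_nonneg fun j _ => by split_ifs <;> simp [hw0]
  have hT : 0 ≤ n / prefixRate p l := (div_pos hn0 (hS l)).le
  refine ⟨x l, Finset.mem_coe.mpr (Finset.mem_image_of_mem x hl), ?_⟩
  have hupper := orderedNorm_le_of_le_prefix hw hw0 (by positivity) (hx l hl).2
  have hlower := le_orderedNorm_of_supported (x := fun i => m' i * p i) hpos hmono hw0 hn0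
    (mul_nonneg hT (hW l)) (fun i => mul_nonneg (Nat.cast_nonneg _) (hpos i).le)
    (g := g) (fun i hi => by simp [hsupp i hi])
    (by
      rw [← hm']
      push_cast
      exact Finset.sum_congr rfl fun i _ => mul_inv_cancel_right₀ (hpos i).ne' _)
    (fun k hk => by
      have := hmin k (hdown k g hk hg)
      rwa [div_mul_eq_mul_div (n : ℝ) (prefixRate p k), le_div_iff₀ (hS k)] at this)
  rw [mul_assoc] at hupper
  linarith
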